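/- arXiv:2201.03373 — 2 statements merged into one kernel-verified Lean document; each statement's English description precedes it below -/
import Mathlib

section
/- There exists a constant κ₂ > 0 (independent of γ, B, δ and r) such that for every γ > 0, B > 0, δ ∈ [0, 1/2) and r > 0, setting B_N = B·N^{−δ}, one has lim_{N→∞} N^{(5−δ)/3}·π_{B_N}({(k,i) ∈ 𝕋×{1,2} : Ψ_{B_N}(k,i) > N·r}) = κ₂·γ^{−5/3}·B^{−1/3}·r^{−5/3}, and likewise lim_{N→∞} N^{(5−δ)/3}·π_{B_N}({(k,i) ∈ 𝕋×{1,2} : Ψ_{B_N}(k,i) < −N·r}) = κ₂·γ^{−5/3}·B^{−1/3}·r^{−5/3}. -/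
open MeasureTheory Filter Topology

/-- `α̂(k) = 4 sin²(πk)`. -/
noncomputable def alphaHat (k : ℝ) : ℝ := 4 * Real.sin (Real.pi * k) ^ 2

/-- `ω_{i,B}(k) = √(α̂(k) + B²/4) ± B/2` (plus sign for `i = 1`, minus for `i = 2`). -/
noncomputable def omegaF (B : ℝ) (i : ℕ) (k : ℝ) : ℝ :=
  Real.sqrt (alphaHat k + B ^ 2 / 4) + (if i = 1 then B / 2 else -(B / 2))

/-- `θ_{i,B}(k) = √(ω_{i,B}(k)/(ω_{1,B}(k) + ω_{2,B}(k)))`. -/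
noncomputable def thetaF (B : ℝ) (i : ℕ) (k : ℝ) : ℝ :=
  Real.sqrt (omegaF B i k / (omegaF B 1 k + omegaF B 2 k))

/-- `v_B(k) = α̂′(k)/(2√(α̂(k) + B²/4))`. -/
noncomputable def vF (B : ℝ) (k : ℝ) : ℝ :=
  deriv alphaHat k / (2 * Real.sqrt (alphaHat k + B ^ 2 / 4))

/-- The scattering kernel `R(k,k′) = 16 sin²(πk) sin²(πk′)`. -/
noncomputable def Rker (k k' : ℝ) : ℝ :=
  16 * Real.sin (Real.pi * k) ^ 2 * Real.sin (Real.pi * k') ^ 2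

/-- `R(k) = ∫_𝕋 R(k,k′) dk′`, with `𝕋` identified with `[-1/2, 1/2)`. -/
noncomputable def Rone (k : ℝ) : ℝ := ∫ k' in Set.Ico (-(1 / 2) : ℝ) (1 / 2), Rker k k'

/-- `R̄ = ∫_𝕋 R(k) dk`. -/
noncomputable def Rbar : ℝ := ∫ k in Set.Ico (-(1 / 2) : ℝ) (1 / 2), Rone k

/-- `λ_B(k,i) = (γ θ_{i,B}(k)² R(k))⁻¹`. -/
noncomputable def lamF (γ B : ℝ) (i : ℕ) (k : ℝ) : ℝ :=
  (γ * thetaF B i k ^ 2 * Rone k)⁻¹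

/-- `Ψ_B(k,i) = v_B(k)·λ_B(k,i)`. -/
noncomputable def PsiF (γ B : ℝ) (i : ℕ) (k : ℝ) : ℝ := vF B k * lamF γ B i k

/-- `π_B(S)` for a subset `S` of `𝕋 × {1,2}`: the measure with density
`λ_B(k,i)⁻¹/(γ R̄)` with respect to `dk ⊗ counting`. -/
noncomputable def piMeasF (γ B : ℝ) (S : ℝ → ℕ → Prop) : ℝ :=
  ∑ i ∈ ({1, 2} : Finset ℕ),
    ∫ k in {k : ℝ | k ∈ Set.Ico (-(1 / 2) : ℝ) (1 / 2) ∧ S k i},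
      (lamF γ B i k)⁻¹ / (γ * Rbar)

/-- The common square root `√(α̂(k) + B²/4)` in the dispersion relations. -/
noncomputable def meanFreq (B k : ℝ) : ℝ :=
  Real.sqrt (4 * Real.sin (Real.pi * k) ^ 2 + B ^ 2 / 4)

lemma half_le_meanFreq (B k : ℝ) : B / 2 ≤ meanFreq B k := by
  apply Real.le_sqrt_of_sq_le
  nlinarith [sq_nonneg (Real.sin (Real.pi * k))]

lemma meanFreq_pos {B : ℝ} (hB : 0 < B) (k : ℝ) : 0 < meanFreq B k :=
  lt_of_lt_of_le (by positivity) (half_le_meanFreq B k)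

lemma meanFreq_sq (B k : ℝ) :
    meanFreq B k ^ 2 = 4 * Real.sin (Real.pi * k) ^ 2 + B ^ 2 / 4 :=
  Real.sq_sqrt (by positivity)

@[fun_prop]
lemma measurable_meanFreq (B : ℝ) : Measurable (meanFreq B) := by
  unfold meanFreq; fun_prop

lemma integral_sin_pi_sq :
    ∫ k in Set.Ico (-(1 / 2) : ℝ) (1 / 2), Real.sin (Real.pi * k) ^ 2 = 1 / 2 := by
  rw [integral_Ico_eq_integral_Ioc, ← intervalIntegral.integral_of_le (by norm_num),
    intervalIntegral.integral_comp_mul_left (fun x => Real.sin x ^ 2) Real.pi_ne_zero,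
    integral_sin_sq]
  have h1 : Real.pi * -(1 / 2) = -(Real.pi / 2) := by ring
  have h2 : Real.pi * (1 / 2) = Real.pi / 2 := by ring
  rw [h1, h2]
  simp only [Real.cos_neg, Real.cos_pi_div_two, Real.sin_neg, Real.sin_pi_div_two, smul_eq_mul]
  field_simp
  ring

lemma Rone_eq (k : ℝ) : Rone k = 8 * Real.sin (Real.pi * k) ^ 2 := by
  unfold Rone Rker
  rw [integral_const_mul, integral_sin_pi_sq]
  ring

lemma Rbar_eq : Rbar = 4 := by
  unfold Rbar
  simp_rw [Rone_eq]
  rw [integral_const_mul, integral_sin_pi_sq]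
  norm_num

lemma hasDerivAt_alphaHat (k : ℝ) :
    HasDerivAt alphaHat (8 * Real.pi * Real.sin (Real.pi * k) * Real.cos (Real.pi * k)) k := by
  unfold alphaHat
  have h := (((((hasDerivAt_id k).const_mul Real.pi).sin).pow 2).const_mul 4)
  refine h.congr_deriv ?_
  simp
  ring

lemma vF_eq (B k : ℝ) :
    vF B k = 4 * Real.pi * Real.sin (Real.pi * k) * Real.cos (Real.pi * k) / meanFreq B k := by
  unfold vF
  rw [(hasDerivAt_alphaHat k).deriv]
  change _ / (2 * meanFreq B k) = _
  rw [show 8 * Real.pi * Real.sin (Real.pi * k) * Real.cos (Real.pi * k)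
    = 2 * (4 * Real.pi * Real.sin (Real.pi * k) * Real.cos (Real.pi * k)) by ring]
  exact mul_div_mul_left _ _ two_ne_zero

lemma thetaF_one_sq {B : ℝ} (hB : 0 < B) (k : ℝ) :
    thetaF B 1 k ^ 2 = (meanFreq B k + B / 2) / (2 * meanFreq B k) := by
  have hw := meanFreq_pos hB k
  have h1 : omegaF B 1 k = meanFreq B k + B / 2 := by simp [omegaF, meanFreq, alphaHat]
  have h2 : omegaF B 2 k = meanFreq B k - B / 2 := by
    simp [omegaF, meanFreq, alphaHat, sub_eq_add_neg]
  rw [thetaF, h1, h2, Real.sq_sqrt]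
  · congr 1; ring
  · have : 0 < meanFreq B k + B / 2 + (meanFreq B k - B / 2) := by linarith
    positivity

lemma thetaF_two_sq {B : ℝ} (hB : 0 < B) (k : ℝ) :
    thetaF B 2 k ^ 2 =
      2 * Real.sin (Real.pi * k) ^ 2 / (meanFreq B k * (meanFreq B k + B / 2)) := by
  have hw := meanFreq_pos hB k
  have hw' := half_le_meanFreq B k
  have h1 : omegaF B 1 k = meanFreq B k + B / 2 := by simp [omegaF, meanFreq, alphaHat]
  have h2 : omegaF B 2 k = meanFreq B k - B / 2 := by
    simp [omegaF, meanFreq, alphaHat, sub_eq_add_neg]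
  have h3 : meanFreq B k + B / 2 + (meanFreq B k - B / 2) = 2 * meanFreq B k := by ring
  rw [thetaF, h1, h2, h3, Real.sq_sqrt]
  · rw [div_eq_div_iff (by positivity) (by positivity)]
    linear_combination meanFreq B k * meanFreq_sq B k
  · exact div_nonneg (by linarith) (by positivity)

lemma density_one {γ B : ℝ} (hγ : 0 < γ) (hB : 0 < B) (k : ℝ) :
    (lamF γ B 1 k)⁻¹ / (γ * Rbar) =
      Real.sin (Real.pi * k) ^ 2 * (meanFreq B k + B / 2) / meanFreq B k := by
  have hw := meanFreq_pos hB k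
  rw [lamF, inv_inv, thetaF_one_sq hB, Rone_eq, Rbar_eq]
  field_simp
  ring

lemma density_two {γ B : ℝ} (hγ : 0 < γ) (hB : 0 < B) (k : ℝ) :
    (lamF γ B 2 k)⁻¹ / (γ * Rbar) =
      4 * Real.sin (Real.pi * k) ^ 4 / (meanFreq B k * (meanFreq B k + B / 2)) := by
  have hw := meanFreq_pos hB k
  rw [lamF, inv_inv, thetaF_two_sq hB, Rone_eq, Rbar_eq]
  field_simp
  ring

lemma lamF_nonneg {γ : ℝ} (hγ : 0 < γ) (B : ℝ) (i : ℕ) (k : ℝ) : 0 ≤ lamF γ B i k := by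
  rw [lamF, Rone_eq]
  positivity

lemma lamF_neg (γ B : ℝ) (i : ℕ) (k : ℝ) : lamF γ B i (-k) = lamF γ B i k := by
  simp [lamF, thetaF, omegaF, alphaHat, Rone_eq]

lemma PsiF_neg (γ B : ℝ) (i : ℕ) (k : ℝ) : PsiF γ B i (-k) = -PsiF γ B i k := by
  simp [PsiF, lamF_neg, vF_eq, meanFreq, neg_div]

lemma PsiF_neg_half (γ B : ℝ) (i : ℕ) : PsiF γ B i (-(1 / 2)) = 0 := by
  have : Real.pi * -(1 / 2) = -(Real.pi / 2) := by ring
  rw [PsiF, vF_eq, this]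
  simp

lemma sin_pi_mul_pos {k : ℝ} (h0 : 0 < k) (h1 : k < 1 / 2) : 0 < Real.sin (Real.pi * k) :=
  Real.sin_pos_of_pos_of_lt_pi (by positivity) (by nlinarith [Real.pi_pos])

lemma two_mul_le_sin_pi_mul {k : ℝ} (h0 : 0 < k) (h1 : k < 1 / 2) :
    2 * k ≤ Real.sin (Real.pi * k) := by
  have h := Real.mul_le_sin (x := Real.pi * k) (by positivity) (by nlinarith [Real.pi_pos])
  have h2 : 2 / Real.pi * (Real.pi * k) = 2 * k := by field_simp
  linarith

lemma PsiF_nonpos {γ : ℝ} (hγ : 0 < γ) (B : ℝ) (i : ℕ) {k : ℝ} (h0 : -(1 / 2) ≤ k)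
    (h1 : k ≤ 0) : PsiF γ B i k ≤ 0 := by
  have hs : Real.sin (Real.pi * k) ≤ 0 :=
    Real.sin_nonpos_of_nonpos_of_neg_pi_le (by nlinarith [Real.pi_pos])
      (by nlinarith [Real.pi_pos])
  have hc : 0 ≤ Real.cos (Real.pi * k) :=
    Real.cos_nonneg_of_neg_pi_div_two_le_of_le (by nlinarith [Real.pi_pos])
      (by nlinarith [Real.pi_pos])
  refine mul_nonpos_of_nonpos_of_nonneg ?_ (lamF_nonneg hγ B i k)
  rw [vF_eq]
  refine div_nonpos_of_nonpos_of_nonneg ?_ (Real.sqrt_nonneg _)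
  have : 0 ≤ 4 * Real.pi * Real.cos (Real.pi * k) := by positivity
  nlinarith

lemma lt_PsiF_one {γ B t k : ℝ} (hγ : 0 < γ) (hB : 0 < B) (h0 : 0 < k) (h1 : k < 1 / 2) :
    t < PsiF γ B 1 k ↔
      t * γ * (Real.sin (Real.pi * k) * (meanFreq B k + B / 2)) <
        Real.pi * Real.cos (Real.pi * k) := by
  have hw := meanFreq_pos hB k
  have hs := sin_pi_mul_pos h0 h1
  have h : PsiF γ B 1 k = Real.pi * Real.cos (Real.pi * k) /
      (γ * (Real.sin (Real.pi * k) * (meanFreq B k + B / 2))) := by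
    rw [PsiF, lamF, vF_eq, thetaF_one_sq hB, Rone_eq]
    field_simp
    ring
  rw [h, lt_div_iff₀ (by positivity), mul_assoc]

lemma lt_PsiF_two {γ B t k : ℝ} (hγ : 0 < γ) (hB : 0 < B) (h0 : 0 < k) (h1 : k < 1 / 2) :
    t < PsiF γ B 2 k ↔
      4 * (t * γ) * Real.sin (Real.pi * k) ^ 3 <
        Real.pi * Real.cos (Real.pi * k) * (meanFreq B k + B / 2) := by
  have hw := meanFreq_pos hB k
  have hs := sin_pi_mul_pos h0 h1
  have h : PsiF γ B 2 k = Real.pi * Real.cos (Real.pi * k) * (meanFreq B k + B / 2) /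
      (4 * γ * Real.sin (Real.pi * k) ^ 3) := by
    rw [PsiF, lamF, vF_eq, thetaF_two_sq hB, Rone_eq]
    field_simp
    ring
  rw [h, lt_div_iff₀ (by positivity)]
  ring_nf

/-- The upper-tail set of the first branch, with `M = γ t` for the threshold `t`. -/
def tailOne (M B : ℝ) : Set ℝ :=
  {k | (0 < k ∧ k < 1 / 2) ∧ M * (Real.sin (Real.pi * k) * (meanFreq B k + B / 2)) <
        Real.pi * Real.cos (Real.pi * k)}

/-- The upper-tail set of the second branch, with `M = γ t` for the threshold `t`. -/
def tailTwo (M B : ℝ) : Set ℝ :=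
  {k | (0 < k ∧ k < 1 / 2) ∧ 4 * M * Real.sin (Real.pi * k) ^ 3 <
        Real.pi * Real.cos (Real.pi * k) * (meanFreq B k + B / 2)}

lemma measurableSet_tailTwo (M B : ℝ) : MeasurableSet (tailTwo M B) := by
  have h1 : MeasurableSet {k : ℝ | 0 < k ∧ k < 1 / 2} := measurableSet_Ioo
  have h2 : MeasurableSet {k : ℝ | 4 * M * Real.sin (Real.pi * k) ^ 3 <
      Real.pi * Real.cos (Real.pi * k) * (meanFreq B k + B / 2)} :=
    measurableSet_lt (by fun_prop) (by fun_prop)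
  exact h1.inter h2

lemma piMeasF_upper_tail {γ B t : ℝ} (hγ : 0 < γ) (hB : 0 < B) (ht : 0 ≤ t) :
    piMeasF γ B (fun k i => t < PsiF γ B i k) =
      (∫ k in tailOne (t * γ) B,
        Real.sin (Real.pi * k) ^ 2 * (meanFreq B k + B / 2) / meanFreq B k) +
      ∫ k in tailTwo (t * γ) B,
        4 * Real.sin (Real.pi * k) ^ 4 / (meanFreq B k * (meanFreq B k + B / 2)) := by
  have hpos : ∀ {i : ℕ} {k : ℝ}, k ∈ Set.Ico (-(1 / 2) : ℝ) (1 / 2) → t < PsiF γ B i k →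
      0 < k ∧ k < 1 / 2 := fun {i k} hk h =>
    ⟨lt_of_not_ge fun hk0 => absurd (PsiF_nonpos hγ B i hk.1 hk0) (by linarith), hk.2⟩
  have e1 : {k : ℝ | k ∈ Set.Ico (-(1 / 2) : ℝ) (1 / 2) ∧ t < PsiF γ B 1 k} =
      tailOne (t * γ) B := by
    ext k
    constructor
    · rintro ⟨hk, h⟩
      have hk' := hpos hk h
      exact ⟨hk', (lt_PsiF_one hγ hB hk'.1 hk'.2).1 h⟩
    · rintro ⟨hk, h⟩
      exact ⟨⟨by linarith [hk.1], hk.2⟩, (lt_PsiF_one hγ hB hk.1 hk.2).2 h⟩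
  have e2 : {k : ℝ | k ∈ Set.Ico (-(1 / 2) : ℝ) (1 / 2) ∧ t < PsiF γ B 2 k} =
      tailTwo (t * γ) B := by
    ext k
    constructor
    · rintro ⟨hk, h⟩
      have hk' := hpos hk h
      exact ⟨hk', (lt_PsiF_two hγ hB hk'.1 hk'.2).1 h⟩
    · rintro ⟨hk, h⟩
      exact ⟨⟨by linarith [hk.1], hk.2⟩, (lt_PsiF_two hγ hB hk.1 hk.2).2 h⟩
  rw [piMeasF, Finset.sum_pair (by norm_num), e1, e2]
  simp_rw [density_one hγ hB, density_two hγ hB]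

lemma piMeasF_lower_tail (γ B : ℝ) {t : ℝ} (ht : 0 ≤ t) :
    piMeasF γ B (fun k i => PsiF γ B i k < -t) =
      piMeasF γ B (fun k i => t < PsiF γ B i k) := by
  refine Finset.sum_congr rfl fun i _ => ?_
  have hmp := Measure.measurePreserving_neg (volume : Measure ℝ)
  have := hmp.setIntegral_preimage_emb (MeasurableEquiv.neg ℝ).measurableEmbedding
    (fun k => (lamF γ B i k)⁻¹ / (γ * Rbar))
    {k : ℝ | k ∈ Set.Ico (-(1 / 2) : ℝ) (1 / 2) ∧ t < PsiF γ B i k}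
  simp only [lamF_neg] at this
  rw [← this]
  congr 2
  ext k
  have hne : ∀ x : ℝ, PsiF γ B i x ≠ 0 → x ≠ -(1 / 2) := by
    rintro x hx rfl
    exact hx (PsiF_neg_half γ B i)
  simp only [Set.mem_ofPred_eq, Set.mem_preimage, Set.mem_Ico, PsiF_neg]
  constructor
  · rintro ⟨⟨h1, h2⟩, h⟩
    have := lt_of_le_of_ne h1 (hne k (by linarith)).symm
    exact ⟨⟨by linarith, by linarith⟩, by linarith⟩
  · rintro ⟨⟨h1, h2⟩, h⟩
    have := lt_of_le_of_ne h1 (hne (-k) (by rw [PsiF_neg]; linarith)).symm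
    exact ⟨⟨by linarith, by linarith⟩, by linarith⟩

lemma norm_integral_tailOne_le {M B : ℝ} (hM : 0 < M) (hB : 0 < B) :
    ‖∫ k in tailOne M B,
        Real.sin (Real.pi * k) ^ 2 * (meanFreq B k + B / 2) / meanFreq B k‖ ≤
      2 * (Real.pi / (M * B)) ^ 3 := by
  set K := Real.pi / (M * B) with hK
  have hK0 : 0 < K := by positivity
  have key : ∀ k ∈ tailOne M B, Real.sin (Real.pi * k) ≤ K := by
    rintro k ⟨⟨h0, h1⟩, h⟩
    have hs := sin_pi_mul_pos h0 h1
    rw [hK, le_div_iff₀ (by positivity)]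
    have h2 : Real.sin (Real.pi * k) * B ≤
        Real.sin (Real.pi * k) * (meanFreq B k + B / 2) := by
      gcongr
      linarith [half_le_meanFreq B k]
    have h3 : Real.pi * Real.cos (Real.pi * k) ≤ Real.pi * 1 := by
      gcongr
      exact Real.cos_le_one _
    nlinarith
  have hsub : tailOne M B ⊆ Set.Ioc 0 K := by
    intro k hk
    have := two_mul_le_sin_pi_mul hk.1.1 hk.1.2
    exact ⟨hk.1.1, by linarith [key k hk, hk.1.1]⟩
  have hIoc : volume (Set.Ioc 0 K) ≠ ⊤ := measure_Ioc_lt_top.ne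
  have hfin : volume (tailOne M B) < ⊤ := (measure_mono hsub).trans_lt hIoc.lt_top
  calc _ ≤ 2 * K ^ 2 * volume.real (tailOne M B) := by
        refine norm_setIntegral_le_of_norm_le_const hfin fun k hk => ?_
        have hs := sin_pi_mul_pos hk.1.1 hk.1.2
        have hw := meanFreq_pos hB k
        rw [Real.norm_of_nonneg (by positivity), div_le_iff₀ hw]
        have h1 : Real.sin (Real.pi * k) ^ 2 ≤ K ^ 2 := by
          gcongr
          exact key k hk
        have h2 : meanFreq B k + B / 2 ≤ 2 * meanFreq B k := by
          linarith [half_le_meanFreq B k]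
        calc _ ≤ K ^ 2 * (2 * meanFreq B k) := by gcongr
          _ = _ := by ring
    _ ≤ 2 * K ^ 2 * volume.real (Set.Ioc 0 K) := by
        gcongr
    _ = _ := by
        rw [Real.volume_real_Ioc_of_le hK0.le]
        ring

lemma le_of_mem_tailTwo {M a b x : ℝ} (ha : 0 < a) (hb : 0 < b) (hab : a ≤ b)
    (hM : 4 * M * Real.pi ^ 2 * a ^ 3 = b) (hx : a * x ∈ tailTwo M b) : 0 < x ∧ x ≤ 100 := by
  obtain ⟨⟨h0, h1⟩, h⟩ := hx
  have hx0 : 0 < x := pos_of_mul_pos_right h0 ha.le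
  refine ⟨hx0, ?_⟩
  have hs := sin_pi_mul_pos h0 h1
  have hs2 := two_mul_le_sin_pi_mul h0 h1
  have hw := meanFreq_pos hb (a * x)
  set s := Real.sin (Real.pi * (a * x))
  have hw2 : meanFreq b (a * x) ≤ 2 * s + b / 2 := by
    refine Real.sqrt_le_iff.2 ⟨by positivity, ?_⟩
    nlinarith [mul_pos hs hb]
  have hc : Real.pi * Real.cos (Real.pi * (a * x)) * (meanFreq b (a * x) + b / 2) ≤
      Real.pi * 1 * (2 * s + b) := by
    gcongr ?_ * ?_
    · gcongr
      exact Real.cos_le_one _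
    · linarith
  obtain ⟨u, hu⟩ : ∃ u, s = a * u := ⟨s / a, by field_simp⟩
  have hu2 : 2 * x ≤ u := by
    rw [hu] at hs2
    exact le_of_mul_le_mul_left (by linarith) ha
  have hu0 : 0 < u := by linarith
  have h3 : b * u ^ 3 < b * (Real.pi ^ 3 * (2 * u + 1)) := by
    calc b * u ^ 3 = Real.pi ^ 2 * (4 * M * s ^ 3) := by
          rw [hu]
          linear_combination -u ^ 3 * hM
      _ < Real.pi ^ 2 * (Real.pi * 1 * (2 * s + b)) := by
          exact mul_lt_mul_of_pos_left (h.trans_le hc) (by positivity)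
      _ = Real.pi ^ 3 * (2 * (a * u) + b) := by rw [hu]; ring
      _ ≤ Real.pi ^ 3 * (2 * (b * u) + b) := by gcongr
      _ = _ := by ring
  have h4 : u ^ 3 < Real.pi ^ 3 * (2 * u + 1) := lt_of_mul_lt_mul_left h3 hb.le
  have h5 : Real.pi ^ 3 ≤ 64 := by
    calc Real.pi ^ 3 ≤ 4 ^ 3 := by gcongr; exact Real.pi_le_four
      _ = 64 := by norm_num
  by_contra! hcon
  have h6 : u ^ 3 < 64 * (2 * u + 1) := h4.trans_le (by gcongr)
  nlinarith [sq_nonneg u, mul_pos hu0 hu0, mul_pos hu0 (mul_pos hu0 hu0)]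

lemma density_two_le {a b x : ℝ} (ha : 0 < a) (hb : 0 < b) (hx : 0 < x)
    (hs : 0 < Real.sin (Real.pi * (a * x))) :
    b ^ 2 / a ^ 4 * (4 * Real.sin (Real.pi * (a * x)) ^ 4 /
      (meanFreq b (a * x) * (meanFreq b (a * x) + b / 2))) ≤ 8 * Real.pi ^ 4 * x ^ 4 := by
  have hsin : Real.sin (Real.pi * (a * x)) ≤ Real.pi * (a * x) := Real.sin_le (by positivity)
  have hw := half_le_meanFreq b (a * x)
  have hw0 := meanFreq_pos hb (a * x)
  calc _ ≤ b ^ 2 / a ^ 4 * (4 * (Real.pi * (a * x)) ^ 4 / (b / 2 * (b / 2 + b / 2))) := by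
        gcongr
    _ = _ := by
        field_simp
        ring

lemma tendsto_integral_tailTwo {M a b : ℕ → ℝ} (ha : ∀ᶠ n in atTop, 0 < a n)
    (hb : ∀ᶠ n in atTop, 0 < b n) (ha0 : Tendsto a atTop (𝓝 0))
    (hab : Tendsto (fun n => a n / b n) atTop (𝓝 0))
    (hM : ∀ᶠ n in atTop, 4 * M n * Real.pi ^ 2 * a n ^ 3 = b n) :
    Tendsto (fun n => b n ^ 2 / a n ^ 5 * ∫ k in tailTwo (M n) (b n),
        4 * Real.sin (Real.pi * k) ^ 4 / (meanFreq (b n) k * (meanFreq (b n) k + b n / 2)))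
      atTop (𝓝 (8 * Real.pi ^ 4 / 5)) := by
  set D : ℕ → ℝ → ℝ := fun n k =>
    4 * Real.sin (Real.pi * k) ^ 4 / (meanFreq (b n) k * (meanFreq (b n) k + b n / 2)) with hD
  set F : ℕ → ℝ → ℝ := fun n x =>
    b n ^ 2 / a n ^ 4 * (tailTwo (M n) (b n)).indicator (D n) (a n * x) with hF
  have hDm : ∀ n, Measurable (D n) := fun n => by fun_prop
  have hscale : ∀ᶠ n in atTop, ∫ x, F n x =
      b n ^ 2 / a n ^ 5 * ∫ k in tailTwo (M n) (b n), D n k := by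
    filter_upwards [ha] with n han
    simp only [hF]
    rw [integral_const_mul,
      Measure.integral_comp_mul_left (fun k => (tailTwo (M n) (b n)).indicator (D n) k) (a n),
      integral_indicator (measurableSet_tailTwo _ _), abs_of_pos (inv_pos.2 han), smul_eq_mul]
    field_simp
  have hab1 : ∀ᶠ n in atTop, a n ≤ b n := by
    filter_upwards [hab.eventually_lt_const one_pos, hb] with n h hbn
    exact ((div_lt_one hbn).1 h).le
  have hlim : ∫ x, (Set.Ioc (0 : ℝ) 1).indicator (fun x => 8 * Real.pi ^ 4 * x ^ 4) x =
      8 * Real.pi ^ 4 / 5 := by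
    rw [integral_indicator measurableSet_Ioc, ← intervalIntegral.integral_of_le zero_le_one,
      intervalIntegral.integral_const_mul, integral_pow]
    norm_num
    ring
  rw [← hlim]
  refine Tendsto.congr' hscale ?_
  refine tendsto_integral_filter_of_dominated_convergence
    ((Set.Ioc (0 : ℝ) 100).indicator fun x => 8 * Real.pi ^ 4 * x ^ 4) ?_ ?_ ?_ ?_
  · refine Eventually.of_forall fun n => Measurable.aestronglyMeasurable ?_
    exact (((hDm n).indicator (measurableSet_tailTwo _ _)).comp
      (measurable_const_mul (a n))).const_mul _
  · filter_upwards [ha, hb, hab1, hM] with n han hbn habn hMn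
    refine Eventually.of_forall fun x => ?_
    by_cases hx : a n * x ∈ tailTwo (M n) (b n)
    · obtain ⟨hx0, hx1⟩ := le_of_mem_tailTwo han hbn habn hMn hx
      have hw := meanFreq_pos hbn (a n * x)
      have hs := sin_pi_mul_pos hx.1.1 hx.1.2
      simp only [hF]
      rw [Set.indicator_of_mem hx, Set.indicator_of_mem (Set.mem_Ioc.2 ⟨hx0, hx1⟩),
        Real.norm_of_nonneg (by positivity)]
      exact density_two_le han hbn hx0 hs
    · simp only [hF]
      rw [Set.indicator_of_notMem hx, mul_zero, norm_zero]
      exact Set.indicator_nonneg (fun x _ => by positivity) x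
  · rw [integrable_indicator_iff measurableSet_Ioc]
    exact (Continuous.integrableOn_Icc (by fun_prop)).mono_set Set.Ioc_subset_Icc_self
  · filter_upwards [Measure.ae_ne volume (1 : ℝ)] with x hx1
    rcases le_or_gt x 0 with hx0 | hx0
    · rw [Set.indicator_of_notMem (fun h => absurd h.1 hx0.not_gt)]
      refine tendsto_const_nhds.congr' ?_
      filter_upwards [ha] with n han
      simp only [hF]
      rw [Set.indicator_of_notMem, mul_zero]
      exact fun h => absurd h.1.1 (mul_nonpos_of_nonneg_of_nonpos han.le hx0).not_gt
    have hax : Tendsto (fun n => a n * x) atTop (𝓝 0) := by simpa using ha0.mul_const x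
    have hpax : Tendsto (fun n => Real.pi * (a n * x)) atTop (𝓝 0) := by
      simpa using hax.const_mul Real.pi
    have hcos : Tendsto (fun n => Real.cos (Real.pi * (a n * x))) atTop (𝓝 1) := by
      simpa [Function.comp_def] using (Real.continuous_cos.tendsto 0).comp hpax
    have hsin : Tendsto (fun n => Real.sin (Real.pi * (a n * x)) / a n) atTop
        (𝓝 (Real.pi * x)) := by
      have h1 : Tendsto (fun n => Real.pi * x * Real.sinc (Real.pi * (a n * x))) atTop
          (𝓝 (Real.pi * x)) := by
        simpa using ((Real.continuous_sinc.tendsto 0).comp hpax).const_mul (Real.pi * x)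
      refine h1.congr' ?_
      filter_upwards [ha] with n han
      rw [Real.sinc_of_ne_zero (by positivity)]
      field_simp
    have hw : Tendsto (fun n => meanFreq (b n) (a n * x) / b n) atTop (𝓝 (1 / 2)) := by
      have h1 : Tendsto (fun n => Real.sqrt (4 * (Real.sin (Real.pi * (a n * x)) / a n) ^ 2 *
          (a n / b n) ^ 2 + 1 / 4)) atTop (𝓝 (1 / 2)) := by
        have := ((((hsin.pow 2).const_mul 4).mul (hab.pow 2)).add_const (1 / 4)).sqrt
        convert this using 2
        rw [show (4 * (Real.pi * x) ^ 2 * 0 ^ 2 + 1 / 4 : ℝ) = (1 / 2) ^ 2 by ring,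
          Real.sqrt_sq (by norm_num)]
      refine h1.congr' ?_
      filter_upwards [ha, hb] with n han hbn
      rw [meanFreq, Real.sqrt_eq_iff_mul_self_eq (by positivity) (by positivity),
        div_mul_div_comm, Real.mul_self_sqrt (by positivity)]
      field_simp
    have hL : Tendsto (fun n => (Real.sin (Real.pi * (a n * x)) / a n) ^ 3 / Real.pi ^ 2) atTop
        (𝓝 (Real.pi * x ^ 3)) := by
      convert (hsin.pow 3).div_const (Real.pi ^ 2) using 2
      field_simp
    have hR : Tendsto (fun n => Real.pi * Real.cos (Real.pi * (a n * x)) *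
        (meanFreq (b n) (a n * x) / b n + 1 / 2)) atTop (𝓝 Real.pi) := by
      convert (hcos.const_mul Real.pi).mul (hw.add_const (1 / 2)) using 2
      ring
    have hmem : ∀ᶠ n in atTop, (a n * x ∈ tailTwo (M n) (b n) ↔
        (Real.sin (Real.pi * (a n * x)) / a n) ^ 3 / Real.pi ^ 2 <
          Real.pi * Real.cos (Real.pi * (a n * x)) *
            (meanFreq (b n) (a n * x) / b n + 1 / 2)) := by
      filter_upwards [ha, hb, hM, hax.eventually_lt_const (show (0 : ℝ) < 1 / 2 by norm_num)]
        with n han hbn hMn hx2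
      have e1 : (Real.sin (Real.pi * (a n * x)) / a n) ^ 3 / Real.pi ^ 2 =
          4 * M n * Real.sin (Real.pi * (a n * x)) ^ 3 / b n := by
        rw [div_pow, div_div, div_eq_div_iff (by positivity) (by positivity)]
        linear_combination -(Real.sin (Real.pi * (a n * x)) ^ 3) * hMn
      have e2 : Real.pi * Real.cos (Real.pi * (a n * x)) *
            (meanFreq (b n) (a n * x) / b n + 1 / 2) =
          Real.pi * Real.cos (Real.pi * (a n * x)) *
            (meanFreq (b n) (a n * x) + b n / 2) / b n := by
        field_simp
      rw [e1, e2, div_lt_div_iff_of_pos_right hbn]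
      exact and_iff_right ⟨by positivity, hx2⟩
    rcases lt_or_gt_of_ne hx1 with hx1 | hx1
    · rw [Set.indicator_of_mem (Set.mem_Ioc.2 ⟨hx0, hx1.le⟩)]
      have hlt : Real.pi * x ^ 3 < Real.pi := by
        have : x ^ 3 < 1 := pow_lt_one₀ hx0.le hx1 (by norm_num)
        nlinarith [Real.pi_pos]
      have hG : Tendsto (fun n => 4 * (Real.sin (Real.pi * (a n * x)) / a n) ^ 4 /
          (meanFreq (b n) (a n * x) / b n * (meanFreq (b n) (a n * x) / b n + 1 / 2))) atTop
          (𝓝 (8 * Real.pi ^ 4 * x ^ 4)) := by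
        have h := ((hsin.pow 4).const_mul 4).div (hw.mul (hw.add_const (1 / 2))) (by norm_num)
        rwa [show 4 * (Real.pi * x) ^ 4 / (1 / 2 * (1 / 2 + 1 / 2)) = 8 * Real.pi ^ 4 * x ^ 4 by
          ring] at h
      refine hG.congr' ?_
      filter_upwards [ha, hb, hmem, hL.eventually_lt hR hlt] with n han hbn hmn hlt
      have := meanFreq_pos hbn (a n * x)
      simp only [hF]
      rw [Set.indicator_of_mem (hmn.2 hlt), hD]
      field_simp
    · rw [Set.indicator_of_notMem (fun h => absurd h.2 hx1.not_ge)]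
      have hlt : Real.pi < Real.pi * x ^ 3 := by
        have : 1 < x ^ 3 := one_lt_pow₀ hx1 (by norm_num)
        nlinarith [Real.pi_pos]
      refine tendsto_const_nhds.congr' ?_
      filter_upwards [hmem, hR.eventually_lt hL hlt] with n hmn hlt
      simp only [hF]
      rw [Set.indicator_of_notMem (fun h => lt_asymm hlt (hmn.1 h)), mul_zero]

lemma tendsto_natCast_rpow_of_neg {p : ℝ} (hp : p < 0) :
    Tendsto (fun N : ℕ => (N : ℝ) ^ p) atTop (𝓝 0) := by
  have := (tendsto_rpow_neg_atTop (neg_pos.2 hp)).comp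
    (tendsto_natCast_atTop_atTop (R := ℝ))
  simpa [Function.comp_def] using this

lemma tendsto_upper_tail {γ B δ r : ℝ} (hγ : 0 < γ) (hB : 0 < B) (hδ0 : 0 ≤ δ)
    (hδ : δ < 1 / 2) (hr : 0 < r) :
    Tendsto (fun N : ℕ => (N : ℝ) ^ ((5 - δ) / 3) *
        piMeasF γ (B * (N : ℝ) ^ (-δ))
          (fun k i => (N : ℝ) * r < PsiF γ (B * (N : ℝ) ^ (-δ)) i k)) atTop
      (𝓝 (8 * Real.pi ^ 4 / 5 * (4 * Real.pi ^ 2) ^ (-(5 / 3) : ℝ) *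
        γ ^ (-(5 / 3) : ℝ) * B ^ (-(1 / 3) : ℝ) * r ^ (-(5 / 3) : ℝ))) := by
  set c : ℝ := (B / (4 * Real.pi ^ 2 * γ * r)) ^ (1 / 3 : ℝ) with hc
  have hc0 : 0 < c := by positivity
  have hc3 : c ^ 3 = B / (4 * Real.pi ^ 2 * γ * r) := by
    rw [hc, ← Real.rpow_natCast, ← Real.rpow_mul (by positivity)]
    norm_num
  have hc5 : c ^ 5 / B ^ 2 = (4 * Real.pi ^ 2) ^ (-(5 / 3) : ℝ) *
        γ ^ (-(5 / 3) : ℝ) * B ^ (-(1 / 3) : ℝ) * r ^ (-(5 / 3) : ℝ) := by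
    rw [hc, ← Real.rpow_natCast, ← Real.rpow_mul (by positivity),
      Real.div_rpow (by positivity) (by positivity), Real.mul_rpow (by positivity) hr.le,
      Real.mul_rpow (by positivity) hγ.le, Real.rpow_neg (by positivity),
      Real.rpow_neg hγ.le, Real.rpow_neg hr.le,
      show (-(1 / 3) : ℝ) = 5 / 3 - 2 by norm_num, Real.rpow_sub hB, Real.rpow_two]
    norm_num
    field_simp
  have hpos : ∀ᶠ N : ℕ in atTop, (0 : ℝ) < N := by
    filter_upwards [eventually_gt_atTop 0] with N hN
    exact_mod_cast hN
  have hmain := tendsto_integral_tailTwo (M := fun N : ℕ => (N : ℝ) * r * γ)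
    (a := fun N : ℕ => c * (N : ℝ) ^ (-(1 + δ) / 3)) (b := fun N : ℕ => B * (N : ℝ) ^ (-δ))
    (by filter_upwards [hpos] with N hN; positivity)
    (by filter_upwards [hpos] with N hN; positivity)
    (by simpa using (tendsto_natCast_rpow_of_neg
      (show -(1 + δ) / 3 < 0 by linarith)).const_mul c)
    (by
      have h := (tendsto_natCast_rpow_of_neg
        (show (2 * δ - 1) / 3 < 0 by linarith)).const_mul (c / B)
      rw [mul_zero] at h
      refine h.congr' ?_
      filter_upwards [hpos] with N hN
      rw [show (2 * δ - 1) / 3 = -(1 + δ) / 3 - -δ by ring, Real.rpow_sub hN]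
      field_simp)
    (by
      filter_upwards [hpos] with N hN
      have e : ((N : ℝ) ^ (-(1 + δ) / 3)) ^ 3 = (N : ℝ) ^ (-δ) / N := by
        rw [← Real.rpow_natCast, ← Real.rpow_mul hN.le,
          show -(1 + δ) / 3 * ((3 : ℕ) : ℝ) = -δ - 1 by push_cast; ring,
          Real.rpow_sub hN, Real.rpow_one]
      rw [mul_pow, hc3, e]
      field_simp)
  have hone : Tendsto (fun N : ℕ => (N : ℝ) ^ ((5 - δ) / 3) *
      ∫ k in tailOne ((N : ℝ) * r * γ) (B * (N : ℝ) ^ (-δ)),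
        Real.sin (Real.pi * k) ^ 2 *
          (meanFreq (B * (N : ℝ) ^ (-δ)) k + B * (N : ℝ) ^ (-δ) / 2) /
          meanFreq (B * (N : ℝ) ^ (-δ)) k) atTop (𝓝 0) := by
    have h := (tendsto_natCast_rpow_of_neg
      (show (8 * δ - 4) / 3 < 0 by linarith)).const_mul (2 * (Real.pi / (r * γ * B)) ^ 3)
    rw [mul_zero] at h
    refine squeeze_zero_norm' ?_ h
    filter_upwards [hpos] with N hN
    rw [norm_mul, Real.norm_of_nonneg (by positivity)]
    calc _ ≤ (N : ℝ) ^ ((5 - δ) / 3) *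
          (2 * (Real.pi / ((N : ℝ) * r * γ * (B * (N : ℝ) ^ (-δ)))) ^ 3) := by
          gcongr
          exact norm_integral_tailOne_le (by positivity) (by positivity)
      _ = _ := by
          have e : (N : ℝ) ^ ((8 * δ - 4) / 3) =
              (N : ℝ) ^ ((5 - δ) / 3) / (N ^ 3 * ((N : ℝ) ^ (-δ)) ^ 3) := by
            rw [show (8 * δ - 4) / 3 = (5 - δ) / 3 - (((3 : ℕ) : ℝ) + -δ * ((3 : ℕ) : ℝ)) by
              push_cast; ring, Real.rpow_sub hN, Real.rpow_add hN, Real.rpow_mul hN.le,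
              Real.rpow_natCast, Real.rpow_natCast]
          rw [e]
          field_simp
  have htot := hone.add (hmain.const_mul (c ^ 5 / B ^ 2))
  rw [zero_add, hc5] at htot
  convert htot.congr' ?_ using 2
  · ring
  filter_upwards [hpos] with N hN
  rw [piMeasF_upper_tail hγ (by positivity) (by positivity), mul_add, ← hc5, ← mul_assoc]
  congr 2
  have e : (N : ℝ) ^ ((5 - δ) / 3) =
      ((N : ℝ) ^ (-δ)) ^ 2 / ((N : ℝ) ^ (-(1 + δ) / 3)) ^ 5 := by
    rw [← Real.rpow_natCast, ← Real.rpow_natCast, ← Real.rpow_mul hN.le, ← Real.rpow_mul hN.le,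
      ← Real.rpow_sub hN]
    congr 1
    push_cast
    ring
  rw [e]
  field_simp

/-- There is a universal constant `κ₂ > 0` such that for all `γ > 0`, `B > 0`,
`δ ∈ [0, 1/2)` and `r > 0`, with `B_N = B·N^(-δ)`,
`N^((5-δ)/3)·π_{B_N}({Ψ_{B_N} > N r}) → κ₂·γ^(-5/3)·B^(-1/3)·r^(-5/3)` and
`N^((5-δ)/3)·π_{B_N}({Ψ_{B_N} < -N r}) → κ₂·γ^(-5/3)·B^(-1/3)·r^(-5/3)` as `N → ∞`. -/
theorem stmt_10 :
    ∃ κ₂ : ℝ, 0 < κ₂ ∧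
      ∀ γ B δ r : ℝ, 0 < γ → 0 < B → 0 ≤ δ → δ < 1 / 2 → 0 < r →
        Tendsto (fun N : ℕ => (N : ℝ) ^ ((5 - δ) / 3) *
            piMeasF γ (B * (N : ℝ) ^ (-δ))
              (fun k i => (N : ℝ) * r < PsiF γ (B * (N : ℝ) ^ (-δ)) i k)) atTop
          (𝓝 (κ₂ * γ ^ (-(5 / 3) : ℝ) * B ^ (-(1 / 3) : ℝ) * r ^ (-(5 / 3) : ℝ))) ∧
        Tendsto (fun N : ℕ => (N : ℝ) ^ ((5 - δ) / 3) *
            piMeasF γ (B * (N : ℝ) ^ (-δ))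
              (fun k i => PsiF γ (B * (N : ℝ) ^ (-δ)) i k < -((N : ℝ) * r))) atTop
          (𝓝 (κ₂ * γ ^ (-(5 / 3) : ℝ) * B ^ (-(1 / 3) : ℝ) * r ^ (-(5 / 3) : ℝ))) := by
  refine ⟨8 * Real.pi ^ 4 / 5 * (4 * Real.pi ^ 2) ^ (-(5 / 3) : ℝ), by positivity, ?_⟩
  intro γ B δ r hγ hB hδ0 hδ hr
  have key := tendsto_upper_tail hγ hB hδ0 hδ hr
  refine ⟨key, key.congr fun N => ?_⟩
  rw [piMeasF_lower_tail _ _ (by positivity)]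
end

section
/- There exists a constant c₁ > 0, independent of γ, such that for every γ > 0 and every p ∈ ℝ, lim_{B→+∞} B^{1/3}·Φ_B(p) = −c₁·γ^{−5/3}·|p|^{5/3}. -/
open Filter Topology MeasureTheory

lemma two_mul_sqrt_add_pos {B ε x : ℝ} (hB : 0 < B) (hε : ε = 1 ∨ ε = -1) (hx : x ≠ 0) :
    0 < 2 * √(x ^ 2 + B ^ 2 / 4) + ε * B := by
  have h : B / 2 < √(x ^ 2 + B ^ 2 / 4) := by
    apply Real.lt_sqrt_of_sq_lt
    have := pow_pos (abs_pos.mpr hx) 2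
    rw [sq_abs] at this
    linarith [show (B / 2) ^ 2 = B ^ 2 / 4 by ring]
  rcases hε with rfl | rfl <;> linarith

lemma half_le_sqrt (B x : ℝ) : B / 2 ≤ √(x ^ 2 + B ^ 2 / 4) := by
  apply Real.le_sqrt_of_sq_le
  linarith [show (B / 2) ^ 2 = B ^ 2 / 4 by ring, sq_nonneg x]

lemma pos_of_momentum_eq {B ε x y : ℝ} (hB : 0 < B) (hε : ε = 1 ∨ ε = -1) (hy : 0 < y)
    (h : (2 * √(x ^ 2 + B ^ 2 / 4) + ε * B) * x = y) : 0 < x := by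
  have h1 := half_le_sqrt B x
  refine pos_of_mul_pos_right (h ▸ hy) ?_
  rcases hε with rfl | rfl <;> linarith

lemma strictMonoOn_momentum {B ε : ℝ} (hB : 0 < B) (hε : ε = 1 ∨ ε = -1) :
    StrictMonoOn (fun t : ℝ => (2 * √(t ^ 2 + B ^ 2 / 4) + ε * B) * t) (Set.Ioi 0) := by
  intro s hs t ht hst
  have hs' : 0 < s := hs
  have h1 : √(s ^ 2 + B ^ 2 / 4) ≤ √(t ^ 2 + B ^ 2 / 4) := by gcongr
  have h2 := two_mul_sqrt_add_pos hB hε hs'.ne'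
  have h3 := two_mul_sqrt_add_pos hB hε (ne_of_gt ht : t ≠ 0)
  show (2 * √(s ^ 2 + B ^ 2 / 4) + ε * B) * s < (2 * √(t ^ 2 + B ^ 2 / 4) + ε * B) * t
  calc _ ≤ (2 * √(t ^ 2 + B ^ 2 / 4) + ε * B) * s := by gcongr
    _ < _ := by gcongr

lemma hasDerivAt_momentum {B ε t : ℝ} (hB : 0 < B) (hε : ε = 1 ∨ ε = -1) :
    HasDerivAt (fun t : ℝ => (2 * √(t ^ 2 + B ^ 2 / 4) + ε * B) * t)
      ((2 * √(t ^ 2 + B ^ 2 / 4) + ε * B) * (4 * √(t ^ 2 + B ^ 2 / 4) - ε * B) /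
        (2 * √(t ^ 2 + B ^ 2 / 4))) t := by
  have hpos : 0 < t ^ 2 + B ^ 2 / 4 := by positivity
  have h1 : HasDerivAt (fun t : ℝ => t ^ 2 + B ^ 2 / 4) (2 * t) t := by
    simpa using (hasDerivAt_pow 2 t).add_const (B ^ 2 / 4)
  have h2 := (((h1.sqrt hpos.ne').const_mul 2).add_const (ε * B)).mul (hasDerivAt_id t)
  refine h2.congr_deriv ?_
  have hE := Real.sqrt_pos.mpr hpos
  have hEs := Real.sq_sqrt hpos.le
  set E := √(t ^ 2 + B ^ 2 / 4)
  have hε2 : ε ^ 2 = 1 := by rcases hε with rfl | rfl <;> norm_num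
  simp only [id]
  field_simp
  have ht2 : t ^ 2 = E ^ 2 - B ^ 2 / 4 := by linarith
  linear_combination (4 : ℝ) * ht2 + (B ^ 2) * hε2

lemma continuousAt_momentum_inverse {γ B ε : ℝ} (hγ : 0 < γ) (hB : 0 < B) (hε : ε = 1 ∨ ε = -1)
    {X : ℝ → ℝ}
    (hX : ∀ r, 0 < r → (2 * √(X r ^ 2 + B ^ 2 / 4) + ε * B) * X r = Real.pi / (γ * r))
    {r : ℝ} (hr : 0 < r) : ContinuousAt X r := by
  have hpos : ∀ r, 0 < r → 0 < X r := fun r hr =>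
    pos_of_momentum_eq hB hε (by positivity) (hX r hr)
  have hmono := strictMonoOn_momentum hB hε
  have hneg : ContinuousAt (fun r => -X r) r := by
    refine continuousAt_of_monotoneOn_of_image_mem_nhds (s := Set.Ioi 0) ?_ (Ioi_mem_nhds hr) ?_
    · intro a ha b hb hab
      have ha' : 0 < a := ha
      refine neg_le_neg ((hmono.le_iff_le (hpos b hb) (hpos a ha)).mp ?_)
      simp only [hX a ha, hX b hb]
      gcongr
    · refine mem_of_superset (Iio_mem_nhds (neg_lt_zero.mpr (hpos r hr))) ?_
      intro s hs
      have ht : 0 < -s := neg_pos.mpr hs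
      have hF := mul_pos (two_mul_sqrt_add_pos hB hε ht.ne') ht
      set y := (2 * √((-s) ^ 2 + B ^ 2 / 4) + ε * B) * -s with hy
      have hr' : 0 < Real.pi / (γ * y) := by positivity
      refine ⟨Real.pi / (γ * y), hr', ?_⟩
      have : X (Real.pi / (γ * y)) = -s := by
        refine hmono.injOn (hpos _ hr') ht ?_
        simp only [hX _ hr']
        rw [← hy]
        field_simp
      simp [this]
  have h := hneg.neg
  simp only [Pi.neg_def, neg_neg] at h
  exact h

lemma deriv_localized_density {γ B ε : ℝ} (hγ : 0 < γ) (hB : 0 < B) (hε : ε = 1 ∨ ε = -1)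
    {X H : ℝ → ℝ}
    (hX : ∀ r, 0 < r → (2 * √(X r ^ 2 + B ^ 2 / 4) + ε * B) * X r = Real.pi / (γ * r))
    (hH : ∀ r, 0 < r → H r = (1 / (4 * Real.pi)) *
      ∫ t in (0 : ℝ)..(X r), (1 / 2 + ε * B / (4 * √(t ^ 2 + B ^ 2 / 4))) * t ^ 2)
    {r : ℝ} (hr : 0 < r) :
    -deriv H r = 1 / (8 * γ * r ^ 2) * (X r ^ 2 / (4 * √(X r ^ 2 + B ^ 2 / 4) - ε * B)) := by
  have hx := pos_of_momentum_eq hB hε (by positivity) (hX r hr)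
  have hF := two_mul_sqrt_add_pos hB hε hx.ne'
  have hE : ∀ t : ℝ, 0 < √(t ^ 2 + B ^ 2 / 4) := fun t => by positivity
  have hQ : 0 < 4 * √(X r ^ 2 + B ^ 2 / 4) - ε * B := by
    have := half_le_sqrt B (X r)
    rcases hε with rfl | rfl <;> linarith
  have hinv := ((hasDerivAt_momentum (t := X r) hB hε).const_mul γ).inv
    (mul_pos hγ (mul_pos hF hx)).ne' |>.const_mul Real.pi
  have hX' := hinv.of_local_left_inverse (continuousAt_momentum_inverse hγ hB hε hX hr)
    (by
      have := hE (X r)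
      have h1 := Real.pi_pos
      refine mul_ne_zero h1.ne' (div_ne_zero (neg_ne_zero.mpr ?_) ?_) <;> positivity) (by
      filter_upwards [Ioi_mem_nhds hr] with s hs
      have hs' : 0 < s := hs
      simp only [Pi.inv_apply, hX s hs]
      field_simp)
  have hcont : Continuous fun t : ℝ => (1 / 2 + ε * B / (4 * √(t ^ 2 + B ^ 2 / 4))) * t ^ 2 := by
    refine Continuous.mul (continuous_const.add (continuous_const.div (by fun_prop) ?_)) (by fun_prop)
    exact fun t => (mul_pos four_pos (hE t)).ne'
  have hint := ((hcont.integral_hasStrictDerivAt 0 (X r)).hasDerivAt.comp r hX').const_mul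
    (1 / (4 * Real.pi))
  have hH' := hint.congr_of_eventuallyEq (f₁ := H) (by
    filter_upwards [Ioi_mem_nhds hr] with s hs
    exact hH s hs)
  rw [hH'.deriv]
  have hr' : r = Real.pi / (γ * ((2 * √(X r ^ 2 + B ^ 2 / 4) + ε * B) * X r)) := by
    rw [hX r hr]; field_simp
  have hEr := hE (X r)
  set x := X r
  set E := √(x ^ 2 + B ^ 2 / 4)
  have hpi := Real.pi_pos
  set P := 2 * E + ε * B with hP
  have hw : 1 / 2 + ε * B / (4 * E) = P / (4 * E) := by rw [hP]; field_simp; ring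
  rw [hw, hr']
  set Q := 4 * E - ε * B
  field_simp
  norm_num

lemma four_mul_cube {B ε x y : ℝ} (hε : ε = 1 ∨ ε = -1)
    (h : (2 * √(x ^ 2 + B ^ 2 / 4) + ε * B) * x = y) :
    4 * x ^ 3 = y * (2 * √(x ^ 2 + B ^ 2 / 4) - ε * B) := by
  have hEs := Real.sq_sqrt (show 0 ≤ x ^ 2 + B ^ 2 / 4 by positivity)
  have hε2 : ε ^ 2 = 1 := by rcases hε with rfl | rfl <;> norm_num
  rw [← h]
  linear_combination (-4 * x) * hEs + (B ^ 2 * x) * hε2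

lemma sq_eq_rpow {x y P : ℝ} (hx : 0 < x) (hy : 0 < y) (hP : 0 < P) (h : 4 * x ^ 3 = y * P) :
    x ^ 2 = (y / 4) ^ (2 / 3 : ℝ) * P ^ (2 / 3 : ℝ) := by
  rw [← Real.mul_rpow (by positivity) hP.le, show y / 4 * P = x ^ 3 by linarith,
    ← Real.rpow_natCast, ← Real.rpow_natCast, ← Real.rpow_mul hx.le]
  norm_num

lemma scaled_sq_div_eq {B ε x y : ℝ} (hB : 0 < B) (hε : ε = 1 ∨ ε = -1) (hy : 0 < y)
    (h : (2 * √(x ^ 2 + B ^ 2 / 4) + ε * B) * x = y) :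
    B ^ (1 / 3 : ℝ) * (x ^ 2 / (4 * √(x ^ 2 + B ^ 2 / 4) - ε * B)) = (y / 4) ^ (2 / 3 : ℝ) *
      (((2 * √(x ^ 2 + B ^ 2 / 4) - ε * B) / B) ^ (2 / 3 : ℝ) /
        ((4 * √(x ^ 2 + B ^ 2 / 4) - ε * B) / B)) := by
  have hx := pos_of_momentum_eq hB hε hy h
  have hε' : -ε = 1 ∨ -ε = -1 := by rcases hε with rfl | rfl <;> norm_num
  have hP := two_mul_sqrt_add_pos hB hε' hx.ne'
  rw [neg_mul, ← sub_eq_add_neg] at hP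
  have hQ : 0 < 4 * √(x ^ 2 + B ^ 2 / 4) - ε * B := by
    have := half_le_sqrt B x
    rcases hε with rfl | rfl <;> linarith
  have hsq := sq_eq_rpow hx hy hP (four_mul_cube hε h)
  set E := √(x ^ 2 + B ^ 2 / 4)
  rw [hsq, Real.div_rpow hP.le hB.le]
  have hB3 : B ^ (1 / 3 : ℝ) * B ^ (2 / 3 : ℝ) = B := by
    rw [← Real.rpow_add hB]; norm_num
  have := Real.rpow_pos_of_pos hB (2 / 3)
  field_simp
  linear_combination hB3

lemma scaled_sq_div_le {B ε x y : ℝ} (hB : 0 < B) (hε : ε = 1 ∨ ε = -1) (hy : 0 < y)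
    (h : (2 * √(x ^ 2 + B ^ 2 / 4) + ε * B) * x = y) :
    B ^ (1 / 3 : ℝ) * (x ^ 2 / (4 * √(x ^ 2 + B ^ 2 / 4) - ε * B)) ≤ (y / 4) ^ (2 / 3 : ℝ) := by
  rw [scaled_sq_div_eq hB hε hy h]
  refine mul_le_of_le_one_right (by positivity) ?_
  have hE := half_le_sqrt B x
  set E := √(x ^ 2 + B ^ 2 / 4)
  have hQ : 1 ≤ (4 * E - ε * B) / B := by
    rw [le_div_iff₀ hB]
    rcases hε with rfl | rfl <;> linarith
  have hP : 0 ≤ (2 * E - ε * B) / B := by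
    apply div_nonneg _ hB.le
    rcases hε with rfl | rfl <;> linarith
  rw [div_le_one (by linarith)]
  calc ((2 * E - ε * B) / B) ^ (2 / 3 : ℝ) ≤ ((4 * E - ε * B) / B) ^ (2 / 3 : ℝ) := by
        gcongr; linarith
    _ ≤ ((4 * E - ε * B) / B) ^ (1 : ℝ) := Real.rpow_le_rpow_of_exponent_le hQ (by norm_num)
    _ = _ := Real.rpow_one _

lemma tendsto_momentum_div {ε y : ℝ} (hε : ε = 1 ∨ ε = -1) (hy : 0 < y) {X : ℝ → ℝ}
    (h : ∀ B, 0 < B → (2 * √(X B ^ 2 + B ^ 2 / 4) + ε * B) * X B = y) :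
    Tendsto (fun B => X B / B) atTop (𝓝 0) := by
  have hcube : Tendsto (fun B => (X B / B) ^ 3) atTop (𝓝 0) := by
    have hlim : Tendsto (fun B : ℝ => 2 * y / B ^ 2) atTop (𝓝 0) :=
      tendsto_const_nhds.div_atTop (tendsto_pow_atTop two_ne_zero)
    refine tendsto_of_tendsto_of_tendsto_of_le_of_le' tendsto_const_nhds hlim ?_ ?_
    · filter_upwards [eventually_gt_atTop 0] with B hB
      have := pos_of_momentum_eq hB hε hy (h B hB)
      positivity
    · filter_upwards [eventually_gt_atTop 0, eventually_ge_atTop (√y)] with B hB hBy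
      have hx := pos_of_momentum_eq hB hε hy (h B hB)
      have hc := four_mul_cube hε (h B hB)
      have hBy' : y ≤ B ^ 2 := Real.sqrt_le_iff.mp hBy |>.2
      have hE : √(X B ^ 2 + B ^ 2 / 4) ≤ X B + B / 2 := by
        apply Real.sqrt_le_iff.mpr
        constructor
        · positivity
        · nlinarith [mul_pos hx hB]
      have hP : 2 * √(X B ^ 2 + B ^ 2 / 4) - ε * B ≤ 2 * X B + 2 * B := by
        rcases hε with rfl | rfl <;> linarith
      have h1 : 4 * X B ^ 3 ≤ y * (2 * X B + 2 * B) := hc ▸ by gcongr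
      obtain ⟨u, hu⟩ : ∃ u, u = X B / B := ⟨_, rfl⟩
      have hXu : X B = u * B := by rw [hu]; field_simp
      have hu0 : 0 < u := by rw [hu]; positivity
      rw [← hu, le_div_iff₀ (by positivity)]
      rw [hXu] at h1
      have h2 : 2 * (u ^ 3 * B ^ 2) ≤ y * (u + 1) := by
        have : 2 * (u ^ 3 * B ^ 2) * (2 * B) ≤ y * (u + 1) * (2 * B) := by linarith
        exact le_of_mul_le_mul_right this (by positivity)
      have h3 : u ≤ u ^ 3 + 1 := by nlinarith [sq_nonneg (u - 1), sq_nonneg u, mul_pos hu0 hu0]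
      nlinarith [mul_le_mul_of_nonneg_left h3 hy.le,
        mul_le_mul_of_nonneg_left hBy' (pow_pos hu0 3).le]
  have hroot := hcube.rpow_const (p := 1 / 3) (Or.inr (by norm_num))
  rw [Real.zero_rpow (by norm_num)] at hroot
  refine hroot.congr' ?_
  filter_upwards [eventually_gt_atTop 0] with B hB
  have := pos_of_momentum_eq hB hε hy (h B hB)
  rw [← Real.rpow_natCast, ← Real.rpow_mul (by positivity)]
  norm_num

lemma tendsto_scaled_sq_div {ε y : ℝ} (hε : ε = 1 ∨ ε = -1) (hy : 0 < y) {X : ℝ → ℝ}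
    (h : ∀ B, 0 < B → (2 * √(X B ^ 2 + B ^ 2 / 4) + ε * B) * X B = y) :
    Tendsto (fun B => B ^ (1 / 3 : ℝ) * (X B ^ 2 / (4 * √(X B ^ 2 + B ^ 2 / 4) - ε * B))) atTop
      (𝓝 ((y / 4) ^ (2 / 3 : ℝ) * ((1 - ε) ^ (2 / 3 : ℝ) / (2 - ε)))) := by
  have hu := tendsto_momentum_div hε hy h
  have hs : Tendsto (fun B => √((X B / B) ^ 2 + 1 / 4)) atTop (𝓝 (1 / 2)) := by
    have := ((hu.pow 2).add_const (1 / 4)).sqrt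
    rwa [show √((0 : ℝ) ^ 2 + 1 / 4) = 1 / 2 by
      rw [show (0 : ℝ) ^ 2 + 1 / 4 = (1 / 2) ^ 2 by norm_num, Real.sqrt_sq (by norm_num)]] at this
  have hP := (((hs.const_mul 2).sub_const ε).rpow_const (p := 2 / 3)
    (Or.inr (by norm_num))).div ((hs.const_mul 4).sub_const ε)
    (by rcases hε with rfl | rfl <;> norm_num)
  have hP' := hP.const_mul ((y / 4) ^ (2 / 3 : ℝ))
  norm_num only at hP'
  refine (hP'.congr' ?_)
  filter_upwards [eventually_gt_atTop 0] with B hB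
  have hE : √(X B ^ 2 + B ^ 2 / 4) = √((X B / B) ^ 2 + 1 / 4) * B := by
    rw [← Real.sqrt_sq hB.le, ← Real.sqrt_mul (by positivity), Real.sqrt_sq hB.le]
    congr 1
    field_simp
  rw [scaled_sq_div_eq hB hε hy (h B hB), hE]
  simp only [Pi.div_apply]
  congr 3
  · field_simp
  · field_simp

lemma integrableOn_one_sub_cos_mul_rpow (p : ℝ) :
    IntegrableOn (fun r : ℝ => (1 - Real.cos (p * r)) * r ^ (-(8 / 3) : ℝ)) (Set.Ioi 0) := by
  have hm : Measurable fun r : ℝ => (1 - Real.cos (p * r)) * r ^ (-(8 / 3) : ℝ) := by fun_prop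
  rw [← Set.Ioc_union_Ioi_eq_Ioi zero_le_one]
  refine IntegrableOn.union ?_ ?_
  · have h : IntegrableOn (fun r : ℝ => p ^ 2 / 2 * r ^ (-(2 / 3) : ℝ)) (Set.Ioc 0 1) := by
      have := intervalIntegral.intervalIntegrable_rpow' (a := 0) (b := 1)
        (show (-1 : ℝ) < -(2 / 3) by norm_num)
      exact ((intervalIntegrable_iff_integrableOn_Ioc_of_le zero_le_one).mp this).const_mul _
    refine h.mono' hm.aestronglyMeasurable ?_
    filter_upwards [ae_restrict_mem measurableSet_Ioc] with r hr
    have hr0 : 0 < r := hr.1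
    have h1 := Real.cos_le_one (p * r)
    have h2 := Real.one_sub_sq_div_two_le_cos (x := p * r)
    rw [Real.norm_of_nonneg (mul_nonneg (by linarith) (by positivity))]
    calc (1 - Real.cos (p * r)) * r ^ (-(8 / 3) : ℝ)
        ≤ (p ^ 2 / 2 * r ^ (2 : ℝ)) * r ^ (-(8 / 3) : ℝ) := by
          rw [Real.rpow_two]; gcongr; linarith [mul_pow p r 2]
      _ = _ := by rw [mul_assoc, ← Real.rpow_add hr0]; norm_num
  · have h : IntegrableOn (fun r : ℝ => 2 * r ^ (-(8 / 3) : ℝ)) (Set.Ioi 1) :=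
      (integrableOn_Ioi_rpow_of_lt (by norm_num) one_pos).const_mul _
    refine h.mono' hm.aestronglyMeasurable ?_
    filter_upwards [ae_restrict_mem measurableSet_Ioi] with r hr
    have hr0 : 0 < r := one_pos.trans hr
    have h1 := Real.cos_le_one (p * r)
    have h2 := Real.neg_one_le_cos (p * r)
    rw [Real.norm_of_nonneg (mul_nonneg (by linarith) (by positivity))]
    gcongr
    linarith

lemma integral_one_sub_cos_mul_rpow_pos :
    0 < ∫ r in Set.Ioi (0 : ℝ), (1 - Real.cos r) * r ^ (-(8 / 3) : ℝ) := by
  have hi := integrableOn_one_sub_cos_mul_rpow 1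
  simp only [one_mul] at hi
  rw [setIntegral_pos_iff_support_of_nonneg_ae _ hi]
  · have hsub : Set.Ioo (0 : ℝ) 1 ⊆ (Function.support fun r : ℝ =>
        (1 - Real.cos r) * r ^ (-(8 / 3) : ℝ)) ∩ Set.Ioi 0 := by
      intro r hr
      refine ⟨?_, hr.1⟩
      have h1 : Real.cos r < 1 := by
        have := Real.cos_lt_cos_of_nonneg_of_le_pi le_rfl
          (hr.2.le.trans (by linarith [Real.pi_gt_three])) hr.1
        rwa [Real.cos_zero] at this
      exact (mul_pos (by linarith) (Real.rpow_pos_of_pos hr.1 _)).ne'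
    refine lt_of_lt_of_le ?_ (measure_mono hsub)
    simp
  · filter_upwards [ae_restrict_mem measurableSet_Ioi] with r hr
    have hr0 : 0 < r := hr
    exact mul_nonneg (by linarith [Real.cos_le_one r]) (by positivity)

lemma integral_one_sub_cos_mul_rpow (p : ℝ) :
    ∫ r in Set.Ioi (0 : ℝ), (1 - Real.cos (p * r)) * r ^ (-(8 / 3) : ℝ) =
      |p| ^ (5 / 3 : ℝ) * ∫ r in Set.Ioi (0 : ℝ), (1 - Real.cos r) * r ^ (-(8 / 3) : ℝ) := by
  rcases eq_or_ne p 0 with rfl | hp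
  · simp
  have hp' : 0 < |p| := abs_pos.mpr hp
  have h := integral_comp_mul_left_Ioi (fun r : ℝ => (1 - Real.cos r) * r ^ (-(8 / 3) : ℝ)) 0 hp'
  rw [mul_zero, smul_eq_mul] at h
  have h2 : ∫ r in Set.Ioi (0 : ℝ), (1 - Real.cos (p * r)) * r ^ (-(8 / 3) : ℝ) =
      |p| ^ (8 / 3 : ℝ) *
        ∫ r in Set.Ioi (0 : ℝ), (1 - Real.cos (|p| * r)) * (|p| * r) ^ (-(8 / 3) : ℝ) := by
    rw [← integral_const_mul]
    refine setIntegral_congr_fun measurableSet_Ioi fun r hr => ?_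
    have hr0 : 0 < r := hr
    have hc : Real.cos (|p| * r) = Real.cos (p * r) := by
      rw [← Real.cos_abs (p * r), abs_mul, abs_of_pos hr0]
    rw [hc, Real.mul_rpow hp'.le hr0.le, Real.rpow_neg hp'.le]
    have := Real.rpow_pos_of_pos hp' (8 / 3)
    field_simp
  rw [h2, h, ← mul_assoc, ← Real.rpow_neg_one, ← Real.rpow_add hp']
  norm_num

lemma exp_mul_inv_mul_rpow {r τ : ℝ} (hr : 0 < r) (hτ : 0 < τ) (M : ℝ) :
    Real.exp (-τ) * τ⁻¹ * (M * (2 * Real.pi * r / τ) ^ (-(8 / 3) : ℝ)) =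
      M * (2 * Real.pi * r) ^ (-(8 / 3) : ℝ) * (Real.exp (-τ) * τ ^ ((8 / 3 : ℝ) - 1)) := by
  have hpi := Real.pi_pos
  rw [Real.div_rpow (by positivity) hτ.le, Real.rpow_neg hτ.le, div_inv_eq_mul,
    Real.rpow_sub_one hτ.ne']
  field_simp

lemma integrableOn_exp_mul_inv_mul_rpow {r : ℝ} (hr : 0 < r) (M : ℝ) :
    IntegrableOn (fun τ : ℝ =>
      Real.exp (-τ) * τ⁻¹ * (M * (2 * Real.pi * r / τ) ^ (-(8 / 3) : ℝ))) (Set.Ioi 0) := by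
  have h := (Real.GammaIntegral_convergent (s := 8 / 3) (by norm_num)).const_mul
    (M * (2 * Real.pi * r) ^ (-(8 / 3) : ℝ))
  exact IntegrableOn.congr_fun h (fun τ hτ => (exp_mul_inv_mul_rpow hr hτ M).symm) measurableSet_Ioi

lemma integral_exp_mul_inv_mul_rpow {r : ℝ} (hr : 0 < r) (M : ℝ) :
    ∫ τ in Set.Ioi (0 : ℝ),
      Real.exp (-τ) * τ⁻¹ * (M * (2 * Real.pi * r / τ) ^ (-(8 / 3) : ℝ)) =
      M * (2 * Real.pi) ^ (-(8 / 3) : ℝ) * Real.Gamma (8 / 3) * r ^ (-(8 / 3) : ℝ) := by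
  rw [setIntegral_congr_fun measurableSet_Ioi fun τ hτ => exp_mul_inv_mul_rpow hr hτ M,
    integral_const_mul, ← Real.Gamma_eq_integral (by norm_num),
    Real.mul_rpow (by positivity) hr.le]
  ring

lemma tendsto_levy_exponent {f : ℝ → ℝ → ℝ} {K M : ℝ}
    (hmeas : ∀ B, 0 < B → ∃ f' : ℝ → ℝ, Measurable f' ∧ Set.EqOn (f B) f' (Set.Ioi 0))
    (hbound : ∀ B, 0 < B → ∀ s, 0 < s → |f B s| ≤ M * s ^ (-(8 / 3) : ℝ))
    (hlim : ∀ s, 0 < s → Tendsto (fun B => f B s) atTop (𝓝 (K * s ^ (-(8 / 3) : ℝ)))) (p : ℝ) :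
    Tendsto (fun B => 2 * ∫ r in Set.Ioi (0 : ℝ), (Real.cos (p * r) - 1) *
      ∫ τ in Set.Ioi (0 : ℝ), Real.exp (-τ) * τ⁻¹ * f B (2 * Real.pi * r / τ)) atTop
      (𝓝 (-(2 * K * (2 * Real.pi) ^ (-(8 / 3) : ℝ) * Real.Gamma (8 / 3) *
        ∫ r in Set.Ioi (0 : ℝ), (1 - Real.cos r) * r ^ (-(8 / 3) : ℝ)) *
          |p| ^ (5 / 3 : ℝ))) := by
  have hpi := Real.pi_pos
  have hin_bound : ∀ B, 0 < B → ∀ r, 0 < r → ∀ᵐ τ ∂(volume.restrict (Set.Ioi (0 : ℝ))),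
      ‖Real.exp (-τ) * τ⁻¹ * f B (2 * Real.pi * r / τ)‖ ≤
        Real.exp (-τ) * τ⁻¹ * (M * (2 * Real.pi * r / τ) ^ (-(8 / 3) : ℝ)) := by
    intro B hB r hr
    filter_upwards [ae_restrict_mem measurableSet_Ioi] with τ hτ
    have hτ' : 0 < τ := hτ
    rw [norm_mul, Real.norm_of_nonneg (by positivity), Real.norm_eq_abs]
    gcongr
    exact hbound B hB _ (by positivity)
  have hin_meas : ∀ B, 0 < B → ∀ r, 0 < r → AEStronglyMeasurable
      (fun τ => Real.exp (-τ) * τ⁻¹ * f B (2 * Real.pi * r / τ))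
      (volume.restrict (Set.Ioi (0 : ℝ))) := by
    intro B hB r hr
    obtain ⟨f', hf', heq⟩ := hmeas B hB
    refine AEStronglyMeasurable.congr
      (f := fun τ => Real.exp (-τ) * τ⁻¹ * f' (2 * Real.pi * r / τ)) ?_ ?_
    · exact Measurable.aestronglyMeasurable (by fun_prop)
    · filter_upwards [ae_restrict_mem measurableSet_Ioi] with τ hτ
      have hτ' : 0 < τ := hτ
      rw [heq (show 0 < 2 * Real.pi * r / τ by positivity)]
  have hin_lim : ∀ r, 0 < r → Tendsto (fun B => ∫ τ in Set.Ioi (0 : ℝ),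
      Real.exp (-τ) * τ⁻¹ * f B (2 * Real.pi * r / τ)) atTop
      (𝓝 (K * (2 * Real.pi) ^ (-(8 / 3) : ℝ) * Real.Gamma (8 / 3) * r ^ (-(8 / 3) : ℝ))) := by
    intro r hr
    rw [← integral_exp_mul_inv_mul_rpow hr K]
    refine tendsto_integral_filter_of_dominated_convergence _ ?_ ?_
      (integrableOn_exp_mul_inv_mul_rpow hr M) ?_
    · filter_upwards [eventually_gt_atTop 0] with B hB using hin_meas B hB r hr
    · filter_upwards [eventually_gt_atTop 0] with B hB using hin_bound B hB r hr
    · filter_upwards [ae_restrict_mem measurableSet_Ioi] with τ hτ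
      have hτ' : 0 < τ := hτ
      exact (hlim _ (by positivity)).const_mul _
  have hout : Tendsto (fun B => ∫ r in Set.Ioi (0 : ℝ), (Real.cos (p * r) - 1) *
      ∫ τ in Set.Ioi (0 : ℝ), Real.exp (-τ) * τ⁻¹ * f B (2 * Real.pi * r / τ)) atTop
      (𝓝 (∫ r in Set.Ioi (0 : ℝ), (Real.cos (p * r) - 1) *
        (K * (2 * Real.pi) ^ (-(8 / 3) : ℝ) * Real.Gamma (8 / 3) * r ^ (-(8 / 3) : ℝ)))) := by
    refine tendsto_integral_filter_of_dominated_convergence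
      (fun r => M * (2 * Real.pi) ^ (-(8 / 3) : ℝ) * Real.Gamma (8 / 3) *
        ((1 - Real.cos (p * r)) * r ^ (-(8 / 3) : ℝ))) ?_ ?_
      ((integrableOn_one_sub_cos_mul_rpow p).const_mul _) ?_
    · filter_upwards [eventually_gt_atTop 0] with B hB
      obtain ⟨f', hf', heq⟩ := hmeas B hB
      refine AEStronglyMeasurable.congr (f := fun r => (Real.cos (p * r) - 1) *
        ∫ τ in Set.Ioi (0 : ℝ), Real.exp (-τ) * τ⁻¹ * f' (2 * Real.pi * r / τ)) ?_ ?_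
      · refine AEStronglyMeasurable.mul (Measurable.aestronglyMeasurable (by fun_prop)) ?_
        have hm : Measurable fun q : ℝ × ℝ =>
            Real.exp (-q.2) * q.2⁻¹ * f' (2 * Real.pi * q.1 / q.2) := by fun_prop
        exact (hm.stronglyMeasurable.integral_prod_right
          (ν := volume.restrict (Set.Ioi (0 : ℝ)))).aestronglyMeasurable
      · filter_upwards [ae_restrict_mem measurableSet_Ioi] with r hr
        have hr' : 0 < r := hr
        congr 1
        refine setIntegral_congr_fun measurableSet_Ioi fun τ hτ => ?_
        have hτ' : 0 < τ := hτ
        rw [heq (show 0 < 2 * Real.pi * r / τ by positivity)]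
    · filter_upwards [eventually_gt_atTop 0] with B hB
      filter_upwards [ae_restrict_mem measurableSet_Ioi] with r hr
      have h1 := Real.cos_le_one (p * r)
      have h2 := norm_integral_le_of_norm_le (integrableOn_exp_mul_inv_mul_rpow hr M)
        (hin_bound B hB r hr)
      rw [integral_exp_mul_inv_mul_rpow hr M] at h2
      rw [norm_mul, Real.norm_of_nonpos (by linarith), neg_sub]
      refine (mul_le_mul_of_nonneg_left h2 (by linarith)).trans_eq ?_
      ring
    · filter_upwards [ae_restrict_mem measurableSet_Ioi] with r hr
      exact (hin_lim r hr).const_mul _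
  convert hout.const_mul 2 using 2
  have : ∀ r : ℝ, (Real.cos (p * r) - 1) *
        (K * (2 * Real.pi) ^ (-(8 / 3) : ℝ) * Real.Gamma (8 / 3) * r ^ (-(8 / 3) : ℝ)) =
      -(K * (2 * Real.pi) ^ (-(8 / 3) : ℝ) * Real.Gamma (8 / 3)) *
        ((1 - Real.cos (p * r)) * r ^ (-(8 / 3) : ℝ)) := fun r => by ring
  simp only [this]
  rw [integral_const_mul, integral_one_sub_cos_mul_rpow]
  ring

lemma inv_mul_sq_mul_rpow {γ s : ℝ} (hγ : 0 < γ) (hs : 0 < s) :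
    1 / (8 * γ * s ^ 2) * (Real.pi / (γ * s) / 4) ^ (2 / 3 : ℝ) =
      (Real.pi / 4) ^ (2 / 3 : ℝ) / 8 * γ ^ (-(5 / 3) : ℝ) * s ^ (-(8 / 3) : ℝ) := by
  have hpi := Real.pi_pos
  rw [show Real.pi / (γ * s) / 4 = Real.pi / 4 / (γ * s) by field_simp,
    Real.div_rpow (by positivity) (by positivity), Real.mul_rpow hγ.le hs.le,
    Real.rpow_neg hγ.le, Real.rpow_neg hs.le, show (5 / 3 : ℝ) = 1 + 2 / 3 by norm_num,
    show (8 / 3 : ℝ) = 2 + 2 / 3 by norm_num, Real.rpow_add hγ, Real.rpow_add hs, Real.rpow_one,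
    Real.rpow_two]
  field_simp



/-- There is a constant `c₁ > 0`, independent of `γ`, such that for every
`γ > 0` and every `p ∈ ℝ`, `B^(1/3)·Φ_B(p) → -c₁·γ^(-5/3)·|p|^(5/3)` as `B → +∞`.  Here, for each
`γ > 0`, the families `x_{B,±}`, `h_{B,±}`, `g_{B,±}` and the Lévy exponent `Φ_B` are
characterized by the hypotheses below. -/
theorem stmt_17 :
    ∃ c₁ : ℝ, 0 < c₁ ∧
      ∀ γ : ℝ, 0 < γ →
        ∀ (x h g : ℝ → ℝ → ℝ → ℝ) (Φ : ℝ → ℝ → ℝ),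
          (∀ B : ℝ, 0 < B → ∀ ε : ℝ, (ε = 1 ∨ ε = -1) → ∀ r : ℝ, r ≠ 0 →
            (2 * Real.sqrt (x B ε r ^ 2 + B ^ 2 / 4) + ε * B) * x B ε r =
              Real.pi / (γ * r)) →
          (∀ B : ℝ, 0 < B → ∀ ε : ℝ, (ε = 1 ∨ ε = -1) → ∀ r : ℝ, r ≠ 0 →
            h B ε r = (1 / (4 * Real.pi)) *
              (if 0 < r then
                ∫ t in (0 : ℝ)..(x B ε r),
                  (1 / 2 + ε * B / (4 * Real.sqrt (t ^ 2 + B ^ 2 / 4))) * t ^ 2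
               else
                ∫ t in (x B ε r)..(0 : ℝ),
                  (1 / 2 + ε * B / (4 * Real.sqrt (t ^ 2 + B ^ 2 / 4))) * t ^ 2)) →
          (∀ B : ℝ, 0 < B → ∀ ε : ℝ, (ε = 1 ∨ ε = -1) → ∀ r : ℝ, r ≠ 0 →
            g B ε r = if 0 < r then -(deriv (h B ε) r) else deriv (h B ε) r) →
          (∀ B : ℝ, 0 < B → ∀ p : ℝ,
            Φ B p = 2 * ∫ r in Set.Ioi (0 : ℝ), (Real.cos (p * r) - 1) *
              ∫ τ in Set.Ioi (0 : ℝ), Real.exp (-τ) * τ⁻¹ *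
                (g B 1 (2 * Real.pi * r / τ) + g B (-1) (2 * Real.pi * r / τ))) →
          ∀ p : ℝ,
            Tendsto (fun B => B ^ ((1 : ℝ) / 3) * Φ B p) atTop
              (𝓝 (-c₁ * γ ^ (-(5 / 3) : ℝ) * |p| ^ ((5 : ℝ) / 3))) := by
  refine ⟨2 * ((Real.pi / 4) ^ (2 / 3 : ℝ) / 8 * (2 ^ (2 / 3 : ℝ) / 3)) *
    (2 * Real.pi) ^ (-(8 / 3) : ℝ) * Real.Gamma (8 / 3) *
      ∫ r in Set.Ioi (0 : ℝ), (1 - Real.cos r) * r ^ (-(8 / 3) : ℝ), ?_, ?_⟩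
  · have h1 := integral_one_sub_cos_mul_rpow_pos
    have h2 := Real.Gamma_pos_of_pos (show (0 : ℝ) < 8 / 3 by norm_num)
    have h3 := Real.pi_pos
    positivity
  intro γ hγ x h g Φ hx hh hg hΦ p
  have hpi := Real.pi_pos
  set K := (Real.pi / 4) ^ (2 / 3 : ℝ) / 8 * γ ^ (-(5 / 3) : ℝ) with hK
  have hgd : ∀ B, 0 < B → ∀ ε : ℝ, (ε = 1 ∨ ε = -1) → ∀ s, 0 < s →
      g B ε s = -deriv (h B ε) s := fun B hB ε hε s hs => by
    rw [hg B hB ε hε s hs.ne', if_pos hs]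
  have hgx : ∀ B, 0 < B → ∀ ε : ℝ, (ε = 1 ∨ ε = -1) → ∀ s, 0 < s →
      g B ε s = 1 / (8 * γ * s ^ 2) *
        (x B ε s ^ 2 / (4 * √(x B ε s ^ 2 + B ^ 2 / 4) - ε * B)) := fun B hB ε hε s hs => by
    rw [hgd B hB ε hε s hs]
    refine deriv_localized_density hγ hB hε (fun r hr => hx B hB ε hε r hr.ne') (fun r hr => ?_) hs
    rw [hh B hB ε hε r hr.ne', if_pos hr]
  have hscaled : ∀ B, 0 < B → ∀ ε : ℝ, (ε = 1 ∨ ε = -1) → ∀ s, 0 < s →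
      |B ^ (1 / 3 : ℝ) * g B ε s| ≤ K * s ^ (-(8 / 3) : ℝ) := by
    intro B hB ε hε s hs
    have hQ : 0 < 4 * √(x B ε s ^ 2 + B ^ 2 / 4) - ε * B := by
      have := half_le_sqrt B (x B ε s)
      rcases hε with rfl | rfl <;> linarith
    rw [hgx B hB ε hε s hs, abs_of_nonneg (by positivity), mul_left_comm, hK,
      ← inv_mul_sq_mul_rpow hγ hs]
    gcongr
    exact scaled_sq_div_le hB hε (by positivity) (hx B hB ε hε s hs.ne')
  have hlim : ∀ ε : ℝ, (ε = 1 ∨ ε = -1) → ∀ s, 0 < s →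
      Tendsto (fun B => B ^ (1 / 3 : ℝ) * g B ε s) atTop
        (𝓝 (K * s ^ (-(8 / 3) : ℝ) * ((1 - ε) ^ (2 / 3 : ℝ) / (2 - ε)))) := by
    intro ε hε s hs
    rw [hK, ← inv_mul_sq_mul_rpow hγ hs, mul_assoc]
    refine ((tendsto_scaled_sq_div hε (by positivity)
      (fun B hB => hx B hB ε hε s hs.ne')).const_mul _).congr' ?_
    filter_upwards [eventually_gt_atTop 0] with B hB
    rw [hgx B hB ε hε s hs, mul_left_comm]
  have hmain := tendsto_levy_exponent (f := fun B s => B ^ (1 / 3 : ℝ) * (g B 1 s + g B (-1) s))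
    (K := K * (2 ^ (2 / 3 : ℝ) / 3)) (M := 2 * K) ?_ ?_ ?_ p
  · convert hmain.congr' ?_ using 2
    · rw [hK]; ring
    · filter_upwards [eventually_gt_atTop 0] with B hB
      rw [hΦ B hB p, mul_left_comm (B ^ (1 / 3 : ℝ)), ← integral_const_mul (B ^ (1 / 3 : ℝ))]
      congr 1
      refine integral_congr_ae (.of_forall fun r => ?_)
      simp only
      rw [mul_left_comm (B ^ (1 / 3 : ℝ)), ← integral_const_mul (B ^ (1 / 3 : ℝ))]
      congr 1
      refine integral_congr_ae (.of_forall fun τ => ?_)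
      simp only
      ring
  · intro B hB
    refine ⟨fun s => B ^ (1 / 3 : ℝ) * (-deriv (h B 1) s + -deriv (h B (-1)) s), ?_, ?_⟩
    · exact measurable_const.mul ((measurable_deriv _).neg.add (measurable_deriv _).neg)
    · intro s hs
      simp only [hgd B hB 1 (Or.inl rfl) s hs, hgd B hB (-1) (Or.inr rfl) s hs]
  · intro B hB s hs
    rw [mul_add]
    refine (abs_add_le _ _).trans ?_
    linarith [hscaled B hB 1 (Or.inl rfl) s hs, hscaled B hB (-1) (Or.inr rfl) s hs]
  · intro s hs
    convert (hlim 1 (Or.inl rfl) s hs).add (hlim (-1) (Or.inr rfl) s hs) using 2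
    · ring
    · norm_num
      ring
end
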